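/- arXiv:2203.05432 — 3 statements merged into one kernel-verified Lean document; each statement's English description precedes it below -/
import Mathlib

section
/- Let n and k be integers with k ≥ 1 and n > k+1, and let ω = ω_{n,k} be the largest real zero of T_n^{(k+1)}. Then τ_{n,k} ≤ (2k-1)!! / ((n+k-1)(n+k-3)⋯(n-k+1)) · (1-ω²)^{-k/2}, where (n+k-1)(n+k-3)⋯(n-k+1) = ∏_{j=1}^{k} (n+k+1-2j). -/
open Polynomial Finset

/-- The odd double factorial `(2k-1)!! = 1·3·5⋯(2k-1)`. -/
noncomputable def oddDoubleFac (k : ℕ) : ℝ := ∏ j ∈ Finset.range k, (2 * (j : ℝ) + 1)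

/-- `∏_{j<i} (m-1-j)(m+j)`, which is `(m+i-1)!/(m-i-1)!` for `i < m`. -/
noncomputable def centralProd (m : ℝ) (i : ℕ) : ℝ := ∏ j ∈ range i, ((m - 1 - j) * (m + j))

lemma centralProd_succ (m : ℝ) (i : ℕ) :
    centralProd m (i + 1) = centralProd m i * ((m - 1 - i) * (m + i)) := by
  simp [centralProd, prod_range_succ]

lemma sub_mul_centralProd_add_one (m : ℝ) (i : ℕ) :
    (m - i) * centralProd (m + 1) i = (m + i) * centralProd m i := by
  induction i with
  | zero => simp [centralProd]
  | succ i ih =>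
    rw [centralProd_succ, centralProd_succ]
    push_cast
    linear_combination (m - i - 1) * (m + 1 + i) * ih

lemma centralProd_succ_right (m : ℝ) (i : ℕ) :
    centralProd m (i + 1) = (m - i) * (m - i - 1) * centralProd (m + 1) i := by
  rw [centralProd_succ]
  linear_combination -(m - 1 - i) * sub_mul_centralProd_add_one m i

lemma centralProd_add_two_succ (m : ℝ) (i : ℕ) :
    centralProd (m + 2) (i + 1) = (m + 1 + i) * (m + 2 + i) * centralProd (m + 1) i := by
  have h := sub_mul_centralProd_add_one (m + 1) i
  rw [centralProd_succ, show m + 2 = m + 1 + 1 by ring]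
  linear_combination (m + 1 + 1 + i) * h

lemma centralProd_natCast_eq_zero {m i : ℕ} (hi : m ≤ i) (hi0 : 0 < i) :
    centralProd m i = 0 := by
  rcases Nat.eq_zero_or_pos m with rfl | hm
  · exact prod_eq_zero (mem_range.2 hi0) (by simp)
  · refine prod_eq_zero (i := m - 1) (mem_range.2 (by omega)) ?_
    rw [Nat.cast_sub hm]
    simp

lemma centralProd_natCast_nonneg (m i : ℕ) : 0 ≤ centralProd m i := by
  rcases le_or_gt m i with h | h
  · rcases Nat.eq_zero_or_pos i with rfl | hi
    · simp [centralProd]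
    · exact (centralProd_natCast_eq_zero h hi).ge
  · refine prod_nonneg fun j hj => mul_nonneg ?_ (by positivity)
    have : (j : ℝ) + 1 ≤ m := by exact_mod_cast (by have := mem_range.1 hj; omega : j + 1 ≤ m)
    linarith

/-- `∏_{j<i} (2j+1) / (2(j+1)(n²-(j+1)²))`. -/
noncomputable def ratioProd (n i : ℕ) : ℝ :=
  ∏ j ∈ range i, ((2 * (j : ℝ) + 1) / (2 * (j + 1) * ((n : ℝ) ^ 2 - (j + 1) ^ 2)))

lemma sq_sub_sq_pos {n j : ℕ} (h : j < n) : 0 < (n : ℝ) ^ 2 - (j : ℝ) ^ 2 := by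
  have : (j : ℝ) < n := by exact_mod_cast h
  have : (0 : ℝ) ≤ j := by positivity
  nlinarith

lemma ratioProd_succ {n i : ℕ} (h : i + 1 < n) :
    2 * ((i : ℝ) + 1) * ((n : ℝ) ^ 2 - (i + 1) ^ 2) * ratioProd n (i + 1) =
      (2 * i + 1) * ratioProd n i := by
  have h1 := sq_sub_sq_pos h
  push_cast at h1
  rw [ratioProd, prod_range_succ, ← ratioProd]
  field_simp

lemma ratioProd_nonneg {n i : ℕ} (h : i < n) : 0 ≤ ratioProd n i := by
  refine prod_nonneg fun j hj => ?_
  have h1 := sq_sub_sq_pos (show j + 1 < n by have := mem_range.1 hj; omega)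
  push_cast at h1
  positivity

/-- The product `∏_{j<m} (n²-j²)`. -/
noncomputable def sqSubProd (n m : ℕ) : ℝ := ∏ j ∈ range m, ((n : ℝ) ^ 2 - (j : ℝ) ^ 2)

lemma sqSubProd_succ (n m : ℕ) :
    sqSubProd n (m + 1) = sqSubProd n m * ((n : ℝ) ^ 2 - (m : ℝ) ^ 2) := by
  simp [sqSubProd, prod_range_succ]

lemma sqSubProd_pos {n m : ℕ} (h : m ≤ n) : 0 < sqSubProd n m :=
  prod_pos fun j hj => sq_sub_sq_pos (by have := mem_range.1 hj; omega)

/-- Coefficients of the squared amplitude of the `m`-th derivative of `exp (i n arccos x)`,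
normalised by `(1 - x²)^m`, as a polynomial in `1 / (1 - x²)`. -/
noncomputable def ampCoeff (n m i : ℕ) : ℝ :=
  sqSubProd n m * ratioProd n i * centralProd m i

lemma ampCoeff_nonneg {n m i : ℕ} (hm : m ≤ n) (hi : i < n) : 0 ≤ ampCoeff n m i :=
  mul_nonneg (mul_nonneg (sqSubProd_pos hm).le (ratioProd_nonneg hi))
    (centralProd_natCast_nonneg m i)

lemma ampCoeff_eq_zero {n m i : ℕ} (hi : m ≤ i) (hi0 : 0 < i) : ampCoeff n m i = 0 := by
  rw [ampCoeff, centralProd_natCast_eq_zero hi hi0, mul_zero]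

lemma sub_mul_ampCoeff_succ (n m i : ℕ) :
    ((m : ℝ) - i) * ampCoeff n (m + 1) i =
      ((n : ℝ) ^ 2 - (m : ℝ) ^ 2) * (m + i) * ampCoeff n m i := by
  have h := sub_mul_centralProd_add_one m i
  simp only [ampCoeff, sqSubProd_succ]
  push_cast
  linear_combination sqSubProd n m * ((n : ℝ) ^ 2 - (m : ℝ) ^ 2) * ratioProd n i * h

/-- Coefficient of the factor `t - 1` in the recurrence for the squared amplitudes. -/
noncomputable def ampStep (n m i : ℕ) : ℝ :=
  (2 * (m : ℝ) + 1) ^ 2 * ampCoeff n (m + 1) i -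
    2 * (2 * (m : ℝ) + 1) * ((n : ℝ) ^ 2 - (m : ℝ) ^ 2) * ((m + i) * ampCoeff n m i)

lemma ampStep_eq (n m i : ℕ) :
    ampStep n m i = (2 * (m : ℝ) + 1) * (2 * i + 1) * ampCoeff n (m + 1) i := by
  rw [ampStep]
  linear_combination 2 * (2 * (m : ℝ) + 1) * sub_mul_ampCoeff_succ n m i

lemma ampCoeff_add_two_zero (n m : ℕ) :
    ampCoeff n (m + 2) 0 =
      ((n : ℝ) ^ 2 - (m : ℝ) ^ 2) ^ 2 * ampCoeff n m 0 - ampStep n m 0 := by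
  rw [ampStep_eq]
  simp only [ampCoeff, sqSubProd_succ, ratioProd, centralProd, range_zero, prod_empty]
  push_cast
  ring

lemma ampCoeff_add_two_succ {n i : ℕ} (m : ℕ) (hi : i + 1 < n) :
    ampCoeff n (m + 2) (i + 1) = ampStep n m i - ampStep n m (i + 1) +
      ((n : ℝ) ^ 2 - (m : ℝ) ^ 2) ^ 2 * ampCoeff n m (i + 1) := by
  rw [ampStep_eq, ampStep_eq]
  simp only [ampCoeff, sqSubProd_succ]
  push_cast
  rw [centralProd_add_two_succ, centralProd_succ_right m, centralProd_succ (m + 1 : ℝ)]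
  linear_combination (2 * (m : ℝ) + 1) * sqSubProd n m * ((n : ℝ) ^ 2 - (m : ℝ) ^ 2) *
    centralProd (m + 1) i * ratioProd_succ hi

lemma sum_shift {N : ℕ} {c d e : ℕ → ℝ} (t : ℝ) (h0 : e 0 = d 0 - c 0)
    (h : ∀ i < N, e (i + 1) = c i - c (i + 1) + d (i + 1)) :
    ∑ i ∈ range (N + 1), e i * t ^ i =
      (t - 1) * ∑ i ∈ range (N + 1), c i * t ^ i + ∑ i ∈ range (N + 1), d i * t ^ i
        - c N * t ^ (N + 1) := by
  induction N with
  | zero => simp [h0]; ring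
  | succ N ih =>
    have ih := ih fun i hi => h i (by omega)
    rw [sum_range_succ, ih, h N (by omega), sum_range_succ _ (N + 1), sum_range_succ _ (N + 1)]
    ring

/-- Closed form for the normalised squared amplitudes `F m`; `G m` is the normalised
correlation of consecutive derivatives. -/
lemma amplitude_eq_sum {n : ℕ} {t : ℝ} {F G : ℕ → ℝ} (hF0 : F 0 = 1) (hF1 : F 1 = (n : ℝ) ^ 2)
    (hG0 : G 0 = 0)
    (hF : ∀ m : ℕ, F (m + 2) = (2 * (m : ℝ) + 1) ^ 2 * (t - 1) * F (m + 1) +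
      ((n : ℝ) ^ 2 - (m : ℝ) ^ 2) ^ 2 * F m -
      2 * (2 * (m : ℝ) + 1) * ((n : ℝ) ^ 2 - (m : ℝ) ^ 2) * (t - 1) * G m)
    (hG : ∀ m : ℕ, G (m + 1) = (2 * (m : ℝ) + 1) * F (m + 1) -
      ((n : ℝ) ^ 2 - (m : ℝ) ^ 2) * G m)
    {m : ℕ} (hm : m + 1 < n) :
    F m = ∑ i ∈ range n, ampCoeff n m i * t ^ i ∧
      G m = ∑ i ∈ range n, (m + i) * ampCoeff n m i * t ^ i ∧
      F (m + 1) = ∑ i ∈ range n, ampCoeff n (m + 1) i * t ^ i := by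
  induction m with
  | zero =>
    obtain ⟨N, rfl⟩ : ∃ N, n = N + 1 := ⟨n - 1, by omega⟩
    refine ⟨?_, ?_, ?_⟩
    · rw [sum_range_succ', sum_eq_zero fun i _ => by
        rw [ampCoeff_eq_zero (by omega) (by omega), zero_mul]]
      simp [hF0, ampCoeff, sqSubProd, ratioProd, centralProd]
    · rw [sum_range_succ', sum_eq_zero fun i _ => by
        rw [ampCoeff_eq_zero (by omega) (by omega), mul_zero, zero_mul]]
      simp [hG0]
    · rw [sum_range_succ', sum_eq_zero fun i _ => by
        rw [ampCoeff_eq_zero (by omega) (by omega), zero_mul]]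
      simp [hF1, ampCoeff, sqSubProd, ratioProd, centralProd]
  | succ m ih =>
    obtain ⟨ih1, ih2, ih3⟩ := ih (by omega)
    refine ⟨ih3, ?_, ?_⟩
    · rw [hG, ih3, ih2, mul_sum, mul_sum, ← sum_sub_distrib]
      refine sum_congr rfl fun i _ => ?_
      push_cast
      linear_combination t ^ i * sub_mul_ampCoeff_succ n m i
    · obtain ⟨N, rfl⟩ : ∃ N, n = N + 1 := ⟨n - 1, by omega⟩
      have hN : ampStep (N + 1) m N = 0 := by
        rw [ampStep_eq, ampCoeff_eq_zero (by omega) (by omega), mul_zero]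
      rw [sum_shift (c := ampStep (N + 1) m)
        (d := fun i => (((N + 1 : ℕ) : ℝ) ^ 2 - (m : ℝ) ^ 2) ^ 2 * ampCoeff (N + 1) m i) t
        (ampCoeff_add_two_zero (N + 1) m)
        fun i hi => ampCoeff_add_two_succ m (Nat.succ_lt_succ hi), hN, hF, ih1, ih2, ih3]
      simp only [ampStep, sub_mul, sum_sub_distrib, mul_assoc, ← mul_sum]
      ring

/-- The modulus at `0` of the `m`-th derivative of `exp (i n arccos x)`. -/
noncomputable def centralAmp (n : ℕ) : ℕ → ℝ
  | 0 => 1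
  | 1 => n
  | m + 2 => ((n : ℝ) ^ 2 - (m : ℝ) ^ 2) * centralAmp n m

lemma centralAmp_pos {n : ℕ} : ∀ {m : ℕ}, m ≤ n → 0 < centralAmp n m
  | 0, _ => by simp [centralAmp]
  | 1, h => by
    simp only [centralAmp]
    exact_mod_cast h
  | m + 2, h => by
    rw [centralAmp]
    exact mul_pos (sq_sub_sq_pos (by omega)) (centralAmp_pos (by omega))

lemma centralAmp_mul_centralAmp_succ (n m : ℕ) :
    centralAmp n m * centralAmp n (m + 1) = n * sqSubProd n m := by
  induction m with
  | zero => simp [centralAmp, sqSubProd]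
  | succ m ih =>
    rw [sqSubProd_succ, centralAmp]
    linear_combination ((n : ℝ) ^ 2 - (m : ℝ) ^ 2) * ih

lemma centralAmp_mul_prod (n : ℕ) : ∀ k : ℕ,
    centralAmp n k * ∏ j ∈ range k, ((n : ℝ) + k - 1 - 2 * j) = sqSubProd n k
  | 0 => by simp [centralAmp, sqSubProd]
  | 1 => by simp [centralAmp, sqSubProd, sq]
  | k + 2 => by
    have ih := centralAmp_mul_prod n k
    rw [centralAmp, sqSubProd_succ, sqSubProd_succ, prod_range_succ, prod_range_succ', ← ih,
      prod_congr rfl fun j _ => show (n : ℝ) + (k + 2 : ℕ) - 1 - 2 * (j + 1 : ℕ) =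
        (n : ℝ) + k - 1 - 2 * j by push_cast; ring]
    push_cast
    ring

lemma centralAmp_sq_le {n : ℕ} {t : ℝ} (ht : 1 ≤ t) {F G : ℕ → ℝ} (hF0 : F 0 = 1)
    (hF1 : F 1 = (n : ℝ) ^ 2) (hG0 : G 0 = 0)
    (hF : ∀ m : ℕ, F (m + 2) = (2 * (m : ℝ) + 1) ^ 2 * (t - 1) * F (m + 1) +
      ((n : ℝ) ^ 2 - (m : ℝ) ^ 2) ^ 2 * F m -
      2 * (2 * (m : ℝ) + 1) * ((n : ℝ) ^ 2 - (m : ℝ) ^ 2) * (t - 1) * G m)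
    (hG : ∀ m : ℕ, G (m + 1) = (2 * (m : ℝ) + 1) * F (m + 1) -
      ((n : ℝ) ^ 2 - (m : ℝ) ^ 2) * G m)
    {m : ℕ} (hm : m + 1 < n) : centralAmp n (m + 1) ^ 2 ≤ F (m + 1) := by
  have h1 : centralAmp n (m + 1) ^ 2 = ∑ i ∈ range n, ampCoeff n (m + 1) i * (1 : ℝ) ^ i :=
    (amplitude_eq_sum (F := fun m => centralAmp n m ^ 2)
      (G := fun m => Nat.rec 0 (fun m g => (2 * (m : ℝ) + 1) * centralAmp n (m + 1) ^ 2 -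
        ((n : ℝ) ^ 2 - (m : ℝ) ^ 2) * g) m)
      (by simp [centralAmp]) (by simp [centralAmp]) rfl
      (fun m => by simp only [centralAmp]; ring) (fun _ => rfl) hm).2.2
  rw [h1, (amplitude_eq_sum hF0 hF1 hG0 hF hG hm).2.2]
  refine sum_le_sum fun i hi => mul_le_mul_of_nonneg_left ?_
    (ampCoeff_nonneg (by omega) (mem_range.1 hi))
  rw [one_pow]
  exact one_le_pow₀ ht

/-- Two solutions `f`, `g` of the recurrence satisfied by the derivatives at `x` of the
real and imaginary parts of `exp (i n arccos x)`: if `f (k + 1) = 0` then `f k` is bounded. -/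
lemma sq_mul_pow_le_centralAmp_sq {n k : ℕ} (hk : k + 1 < n) {x : ℝ} (hx : 0 < 1 - x ^ 2)
    {f g : ℕ → ℝ}
    (hf : ∀ m : ℕ, (1 - x ^ 2) * f (m + 2) =
      (2 * m + 1) * x * f (m + 1) - ((n : ℝ) ^ 2 - (m : ℝ) ^ 2) * f m)
    (hg : ∀ m : ℕ, (1 - x ^ 2) * g (m + 2) =
      (2 * m + 1) * x * g (m + 1) - ((n : ℝ) ^ 2 - (m : ℝ) ^ 2) * g m)
    (h00 : f 0 ^ 2 + g 0 ^ 2 = 1) (h01 : f 0 * f 1 + g 0 * g 1 = 0)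
    (h11 : (1 - x ^ 2) * (f 1 ^ 2 + g 1 ^ 2) = (n : ℝ) ^ 2) (hfk : f (k + 1) = 0) :
    f k ^ 2 * (1 - x ^ 2) ^ k ≤ centralAmp n k ^ 2 := by
  set s := 1 - x ^ 2 with hs
  have hW : ∀ m : ℕ, s ^ (2 * m + 1) * (f m * g (m + 1) - g m * f (m + 1)) ^ 2 =
      (n * sqSubProd n m) ^ 2 := by
    intro m
    induction m with
    | zero =>
      simp only [sqSubProd, range_zero, prod_empty]
      linear_combination s * (f 1 ^ 2 + g 1 ^ 2) * h00 -
        s * (f 0 * f 1 + g 0 * g 1) * h01 + h11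
    | succ m ih =>
      have h : s * (f (m + 1) * g (m + 2) - g (m + 1) * f (m + 2)) =
          ((n : ℝ) ^ 2 - (m : ℝ) ^ 2) * (f m * g (m + 1) - g m * f (m + 1)) := by
        linear_combination f (m + 1) * hg m - g (m + 1) * hf m
      calc _ = s ^ (2 * m + 1) * (s * (f (m + 1) * g (m + 2) - g (m + 1) * f (m + 2))) ^ 2 := by
            ring
        _ = ((n : ℝ) ^ 2 - (m : ℝ) ^ 2) ^ 2 *
            (s ^ (2 * m + 1) * (f m * g (m + 1) - g m * f (m + 1)) ^ 2) := by rw [h]; ring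
        _ = _ := by rw [ih, sqSubProd_succ]; ring
  set F : ℕ → ℝ := fun m => s ^ m * (f m ^ 2 + g m ^ 2) with hFdef
  set G : ℕ → ℝ := fun m => Nat.rec 0 (fun m c => (2 * (m : ℝ) + 1) * F (m + 1) -
        ((n : ℝ) ^ 2 - (m : ℝ) ^ 2) * c) m with hGdef
  have hG : ∀ m : ℕ, G (m + 1) = (2 * (m : ℝ) + 1) * F (m + 1) -
      ((n : ℝ) ^ 2 - (m : ℝ) ^ 2) * G m := fun _ => rfl
  have hR : ∀ m : ℕ, s ^ (m + 1) * (f m * f (m + 1) + g m * g (m + 1)) = x * G m := by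
    intro m
    induction m with
    | zero =>
      rw [show G 0 = 0 from rfl]
      linear_combination s * h01
    | succ m ih =>
      rw [hG]
      simp only [hFdef]
      linear_combination s ^ (m + 1) * (f (m + 1) * hf m + g (m + 1) * hg m) -
        ((n : ℝ) ^ 2 - (m : ℝ) ^ 2) * ih
  have ht : 1 ≤ s⁻¹ := (one_le_inv₀ hx).2 (by nlinarith [sq_nonneg x])
  have hst : x ^ 2 * s⁻¹ = s⁻¹ - 1 := by
    field_simp
    linarith
  have hle : centralAmp n (k + 1) ^ 2 ≤ F (k + 1) := by
    refine centralAmp_sq_le ht (F := F) (G := G) ?_ ?_ rfl ?_ hG hk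
    · simpa [hFdef] using h00
    · simpa [hFdef] using h11
    · intro m
      have hsi : s * s⁻¹ = 1 := mul_inv_cancel₀ hx.ne'
      have hmul : s * F (m + 2) = s * ((2 * (m : ℝ) + 1) ^ 2 * (s⁻¹ - 1) * F (m + 1) +
          ((n : ℝ) ^ 2 - (m : ℝ) ^ 2) ^ 2 * F m -
          2 * (2 * (m : ℝ) + 1) * ((n : ℝ) ^ 2 - (m : ℝ) ^ 2) * (s⁻¹ - 1) * G m) := by
        rw [← hst]
        have hexp : s * F (m + 2) = s ^ (m + 1) *
            ((s * f (m + 2)) ^ 2 + (s * g (m + 2)) ^ 2) := by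
          simp only [hFdef]; ring
        rw [hexp, hf, hg]
        have hR' := hR m
        simp only [hFdef]
        linear_combination (-2 * (2 * (m : ℝ) + 1) * ((n : ℝ) ^ 2 - (m : ℝ) ^ 2) * x) * hR' -
          ((2 * (m : ℝ) + 1) ^ 2 * x ^ 2 * s ^ (m + 1) * (f (m + 1) ^ 2 + g (m + 1) ^ 2) -
            2 * (2 * (m : ℝ) + 1) * ((n : ℝ) ^ 2 - (m : ℝ) ^ 2) * x ^ 2 * G m) * hsi
      exact mul_left_cancel₀ hx.ne' hmul
  have hpos := centralAmp_pos hk.le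
  have hWk := hW k
  rw [← centralAmp_mul_centralAmp_succ, hfk] at hWk
  simp only [hFdef, hfk] at hle
  refine le_of_mul_le_mul_right ?_ (pow_pos hpos 2)
  calc f k ^ 2 * s ^ k * centralAmp n (k + 1) ^ 2
      ≤ f k ^ 2 * s ^ k * (s ^ (k + 1) * (0 ^ 2 + g (k + 1) ^ 2)) := by gcongr
    _ = centralAmp n k ^ 2 * centralAmp n (k + 1) ^ 2 := by rw [← mul_pow, ← hWk]; ring

/-- The continuation of two initial values by the three-term recurrence satisfied by the
successive derivatives at `x` of solutions of the Chebyshev equation. -/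
noncomputable def chebyshevJet (n : ℕ) (x a b : ℝ) : ℕ → ℝ
  | 0 => a
  | 1 => b
  | m + 2 => ((2 * m + 1) * x * chebyshevJet n x a b (m + 1) -
      ((n : ℝ) ^ 2 - (m : ℝ) ^ 2) * chebyshevJet n x a b m) / (1 - x ^ 2)

lemma eval_T_sq_add_eval_U_sq (n : ℤ) {x : ℝ} (h1 : -1 ≤ x) (h2 : x ≤ 1) :
    (Chebyshev.T ℝ n).eval x ^ 2 + (1 - x ^ 2) * (Chebyshev.U ℝ (n - 1)).eval x ^ 2 = 1 := by
  have hT := Chebyshev.T_real_cos (Real.arccos x) n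
  have hU := Chebyshev.U_real_cos (Real.arccos x) (n - 1)
  have hsq := Real.sin_sq_add_cos_sq (Real.arccos x)
  have hsq' := Real.sin_sq_add_cos_sq (n * Real.arccos x)
  push_cast at hU
  rw [sub_add_cancel] at hU
  rw [Real.cos_arccos h1 h2] at hT hU hsq
  rw [← hT, ← hU] at hsq'
  linear_combination hsq' - (Chebyshev.U ℝ (n - 1)).eval x ^ 2 * hsq

/-- At a zero of `T_n^{(k+1)}` in `(-1, 1)`, `(1 - x²)^{k/2} T_n^{(k)}` is bounded by
its amplitude at `0`. -/
lemma sq_eval_iterate_derivative_T_le {n k : ℕ} (hk : k + 1 < n) {x : ℝ} (hx1 : -1 < x)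
    (hx2 : x < 1) (hroot : (derivative^[k + 1] (Chebyshev.T ℝ (n : ℤ))).eval x = 0) :
    (derivative^[k] (Chebyshev.T ℝ (n : ℤ))).eval x ^ 2 * (1 - x ^ 2) ^ k ≤
      centralAmp n k ^ 2 := by
  have hs : 0 < 1 - x ^ 2 := by nlinarith
  have hr : √(1 - x ^ 2) ^ 2 = 1 - x ^ 2 := Real.sq_sqrt hs.le
  have hr0 : √(1 - x ^ 2) ≠ 0 := (Real.sqrt_pos.2 hs).ne'
  have hP := eval_T_sq_add_eval_U_sq n hx1.le hx2.le
  have hT1 : (derivative^[1] (Chebyshev.T ℝ (n : ℤ))).eval x =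
      n * (Chebyshev.U ℝ ((n : ℤ) - 1)).eval x := by
    simp [Chebyshev.T_derivative_eq_U]
  refine sq_mul_pow_le_centralAmp_sq (n := n) hk hs
    (f := fun m => (derivative^[m] (Chebyshev.T ℝ (n : ℤ))).eval x)
    (g := chebyshevJet n x (√(1 - x ^ 2) * (Chebyshev.U ℝ ((n : ℤ) - 1)).eval x)
      (-n * (Chebyshev.T ℝ (n : ℤ)).eval x / √(1 - x ^ 2)))
    (fun m => ?_) (fun m => ?_) ?_ ?_ ?_ hroot
  · simpa using Chebyshev.one_sub_X_sq_mul_iterate_derivative_T_eval (R := ℝ) n m x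
  · rw [chebyshevJet]
    field_simp
  · simp only [chebyshevJet, Function.iterate_zero_apply, mul_pow, hr]
    exact hP
  · simp only [chebyshevJet, hT1, Function.iterate_zero_apply]
    field_simp
    ring
  · simp only [chebyshevJet, hT1, div_pow, hr]
    field_simp
    linear_combination (n : ℝ) ^ 2 * hP

lemma eval_one_le_eval_iterate_derivative_T (n k : ℕ) {x : ℝ} (hx : 1 ≤ x) :
    (derivative^[k] (Chebyshev.T ℝ (n : ℤ))).eval 1 ≤
      (derivative^[k] (Chebyshev.T ℝ (n : ℤ))).eval x := by
  refine Submodule.span_induction (p := fun q _ => q.eval 1 ≤ q.eval x) ?_ (by simp) ?_ ?_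
    (Chebyshev.T_iterate_derivative_mem_span_T (R := ℝ) n k)
  · rintro _ ⟨m, -, rfl⟩
    simpa using Chebyshev.one_le_eval_T_real m hx
  · intro p q _ _ hp hq
    simpa using add_le_add hp hq
  · intro c q _ hq
    simpa using mul_le_mul_of_nonneg_left hq c.cast_nonneg

lemma oddDoubleFac_mul_eval_one (n k : ℕ) :
    oddDoubleFac k * (derivative^[k] (Chebyshev.T ℝ (n : ℤ))).eval 1 = sqSubProd n k := by
  simpa [oddDoubleFac, sqSubProd] using Chebyshev.iterate_derivative_T_eval_one (R := ℝ) n k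

lemma oddDoubleFac_pos (k : ℕ) : 0 < oddDoubleFac k :=
  prod_pos fun _ _ => by positivity

lemma eval_one_iterate_derivative_T_pos {n k : ℕ} (h : k ≤ n) :
    0 < (derivative^[k] (Chebyshev.T ℝ (n : ℤ))).eval 1 := by
  refine pos_of_mul_pos_right ?_ (oddDoubleFac_pos k).le
  rw [oddDoubleFac_mul_eval_one]
  exact sqSubProd_pos h

lemma iterate_derivative_comp_neg_X (p : ℝ[X]) (k : ℕ) :
    derivative^[k] (p.comp (-X)) = (-1) ^ k * (derivative^[k] p).comp (-X) := by
  induction k generalizing p with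
  | zero => simp
  | succ k ih => simp [ih, derivative_comp, pow_succ]

lemma abs_eval_iterate_derivative_T_neg (n k : ℕ) (x : ℝ) :
    |(derivative^[k] (Chebyshev.T ℝ (n : ℤ))).eval (-x)| =
      |(derivative^[k] (Chebyshev.T ℝ (n : ℤ))).eval x| := by
  have hpar : (Chebyshev.T ℝ (n : ℤ)).comp (-X) =
      C (((n : ℤ).negOnePow : ℤ) : ℝ) * Chebyshev.T ℝ (n : ℤ) := by
    refine Polynomial.funext fun y => ?_
    simp [Chebyshev.T_eval_neg]
  have h := congrArg (fun p => |p.eval x|) (congrArg derivative^[k] hpar)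
  have h1 : |(((n : ℤ).negOnePow : ℤ) : ℝ)| = 1 := by
    rcases Int.units_eq_one_or (n : ℤ).negOnePow with h | h <;> simp [h]
  simp only [iterate_derivative_comp_neg_X, iterate_derivative_C_mul, eval_mul, eval_C, abs_mul,
    h1, one_mul] at h
  simpa using h

theorem stmt1 (n k : ℕ) (hk : 1 ≤ k) (hn : k + 1 < n) (ω : ℝ)
    (hωroot : (derivative^[k + 1] (Chebyshev.T ℝ (n : ℤ))).eval ω = 0)
    (hωmax : ∀ x : ℝ, (derivative^[k + 1] (Chebyshev.T ℝ (n : ℤ))).eval x = 0 → x ≤ ω) :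
    |(derivative^[k] (Chebyshev.T ℝ (n : ℤ))).eval ω| /
        (derivative^[k] (Chebyshev.T ℝ (n : ℤ))).eval 1 ≤
      oddDoubleFac k / (∏ j ∈ Finset.Icc 1 k, ((n : ℝ) + (k : ℝ) + 1 - 2 * (j : ℝ))) *
        ((1 - ω ^ 2) ^ ((k : ℝ) / 2))⁻¹ := by
  have hω0 : -ω ≤ ω := by
    refine hωmax _ (abs_eq_zero.1 ?_)
    rw [abs_eval_iterate_derivative_T_neg, hωroot, abs_zero]
  have hω1 : ω < 1 := by
    by_contra! h
    have h1 := eval_one_le_eval_iterate_derivative_T n (k + 1) h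
    have h2 := eval_one_iterate_derivative_T_pos hn.le
    linarith
  have hs : 0 < 1 - ω ^ 2 := by nlinarith
  have hbound := sq_eval_iterate_derivative_T_le hn (by linarith) hω1 hωroot
  have hA := centralAmp_pos (show k ≤ n by omega)
  have hprod : ∏ j ∈ Finset.Icc 1 k, ((n : ℝ) + (k : ℝ) + 1 - 2 * (j : ℝ)) =
      ∏ j ∈ range k, ((n : ℝ) + k - 1 - 2 * j) := by
    rw [← Finset.Ico_add_one_right_eq_Icc, prod_Ico_eq_prod_range]
    refine prod_congr rfl fun j _ => ?_
    push_cast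
    ring
  have hT := eval_one_iterate_derivative_T_pos (show k ≤ n by omega)
  have hodd := oddDoubleFac_mul_eval_one n k
  have hcentral := centralAmp_mul_prod n k
  have hK := sqSubProd_pos (show k ≤ n by omega)
  rw [hprod]
  set P := ∏ j ∈ range k, ((n : ℝ) + k - 1 - 2 * j)
  have hP : 0 < P := pos_of_mul_pos_right (hcentral ▸ hK) hA.le
  have hpow : ((1 - ω ^ 2) ^ ((k : ℝ) / 2)) ^ 2 = (1 - ω ^ 2) ^ k := by
    rw [← Real.rpow_natCast _ k, ← Real.rpow_natCast _ 2, ← Real.rpow_mul hs.le, Nat.cast_ofNat,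
      div_mul_cancel₀ _ two_ne_zero]
  have hpos : 0 < (1 - ω ^ 2) ^ ((k : ℝ) / 2) := Real.rpow_pos_of_pos hs _
  rw [← hpow, ← mul_pow] at hbound
  have hle : |(derivative^[k] (Chebyshev.T ℝ (n : ℤ))).eval ω| *
      (1 - ω ^ 2) ^ ((k : ℝ) / 2) ≤ centralAmp n k := by
    rw [← abs_of_pos hpos, ← abs_mul]
    exact abs_le_of_sq_le_sq hbound hA.le
  rw [← div_eq_mul_inv, div_div, div_le_div_iff₀ hT (mul_pos hP hpos), hodd, ← hcentral]
  nlinarith [mul_le_mul_of_nonneg_left hle hP.le]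
end

section
/- Let k ≥ 1 be an integer and suppose the sequence (τ_{n,k})_{n > k+1} converges to a real number τ_k* as n → ∞. Then τ_k* ≤ (2k-1)!! / (k+2)^k. -/
open Polynomial Finset

namespace Polynomial.Chebyshev

/-- The value at `x` of the `j`-th derivative of the Chebyshev polynomial `T_n`. -/
noncomputable def iterDerivT (n j : ℕ) (x : ℝ) : ℝ :=
  (derivative^[j] (T ℝ (n : ℤ))).eval x

theorem hasDerivAt_iterDerivT (n j : ℕ) (x : ℝ) :
    HasDerivAt (iterDerivT n j) (iterDerivT n (j + 1) x) x := by
  unfold iterDerivT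
  rw [Function.iterate_succ_apply']
  exact Polynomial.hasDerivAt _ x

theorem continuous_iterDerivT (n j : ℕ) : Continuous (iterDerivT n j) :=
  Polynomial.continuous _

theorem iterDerivT_ode (n j : ℕ) (x : ℝ) :
    (1 - x ^ 2) * iterDerivT n (j + 2) x =
      (2 * j + 1) * x * iterDerivT n (j + 1) x - (n ^ 2 - j ^ 2) * iterDerivT n j x := by
  simpa [iterDerivT] using one_sub_X_sq_mul_iterate_derivative_T_eval (R := ℝ) (n : ℤ) j x

theorem iterDerivT_nonneg (n j : ℕ) {x : ℝ} (hx : 1 ≤ x) : 0 ≤ iterDerivT n j x := by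
  have h := T_iterate_derivative_mem_span_T (R := ℝ) n j
  unfold iterDerivT
  generalize derivative^[j] (T ℝ (n : ℤ)) = p at h
  induction h using Submodule.span_induction with
  | mem p hp =>
    obtain ⟨m, -, rfl⟩ := hp
    exact zero_le_one.trans (one_le_eval_T_real m hx)
  | zero => simp
  | add p q _ _ hp hq => simpa using add_nonneg hp hq
  | smul c p _ hp => simpa using mul_nonneg c.cast_nonneg hp

theorem iterDerivT_one (n j : ℕ) :
    iterDerivT n j 1 = (∏ l ∈ range j, ((n : ℝ) ^ 2 - (l : ℝ) ^ 2)) / oddDoubleFac j := by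
  simpa [iterDerivT, oddDoubleFac] using iterate_derivative_T_eval_one_eq_div (𝔽 := ℝ) (n : ℤ) j

theorem oddDoubleFac_pos (j : ℕ) : 0 < oddDoubleFac j :=
  prod_pos fun _ _ => by positivity

theorem iterDerivT_one_pos {n j : ℕ} (hj : j ≤ n) : 0 < iterDerivT n j 1 := by
  rw [iterDerivT_one]
  refine div_pos (prod_pos fun l hl => ?_) (oddDoubleFac_pos j)
  have hl' : (l : ℝ) < n := by exact_mod_cast (mem_range.mp hl).trans_le hj
  exact sub_pos.mpr (pow_lt_pow_left₀ hl' l.cast_nonneg two_ne_zero)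

theorem lt_one_of_iterDerivT_eq_zero {n j : ℕ} (hj : j ≤ n) {x : ℝ}
    (hx : iterDerivT n j x = 0) : x < 1 := by
  by_contra! h
  have hmono : MonotoneOn (iterDerivT n j) (Set.Ici 1) := by
    refine monotoneOn_of_deriv_nonneg (convex_Ici 1) (continuous_iterDerivT n j).continuousOn
      (fun y _ => (hasDerivAt_iterDerivT n j y).differentiableAt.differentiableWithinAt)
      fun y hy => ?_
    rw [(hasDerivAt_iterDerivT n j y).deriv]
    rw [interior_Ici] at hy
    exact iterDerivT_nonneg n _ (le_of_lt hy)
  have := hmono (Set.mem_Ici.mpr le_rfl) h h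
  linarith [iterDerivT_one_pos hj]

theorem exists_iterDerivT_neg (n j : ℕ) :
    ∃ c : ℝ, ∀ x, iterDerivT n j (-x) = c * iterDerivT n j x := by
  induction j with
  | zero => exact ⟨_, fun x => T_eval_neg ℝ (n : ℤ) x⟩
  | succ j ih =>
    obtain ⟨c, hc⟩ := ih
    refine ⟨-c, fun x => ?_⟩
    have h₁ : HasDerivAt (fun y => iterDerivT n j (-y)) (-iterDerivT n (j + 1) (-x)) x := by
      simpa [Function.comp_def] using (hasDerivAt_iterDerivT n j (-x)).comp x (hasDerivAt_neg x)
    have h₂ : HasDerivAt (fun y => iterDerivT n j (-y)) (c * iterDerivT n (j + 1) x) x := by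
      simp_rw [hc]
      exact (hasDerivAt_iterDerivT n j x).const_mul c
    linarith [h₁.unique h₂]

theorem iterDerivT_zero_sq_add_le {n j : ℕ} (hj : j ≤ n) :
    (n : ℝ) ^ 2 * iterDerivT n j 0 ^ 2 + iterDerivT n (j + 1) 0 ^ 2 ≤ (n : ℝ) ^ (2 * j + 2) := by
  induction j with
  | zero =>
    have hT : iterDerivT n 0 0 = (T ℝ (n : ℤ)).eval 0 := rfl
    have hU : iterDerivT n 1 0 = n * (U ℝ ((n : ℤ) - 1)).eval 0 := by
      simp [iterDerivT, T_derivative_eq_U]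
    have hsq : ∀ m : ℤ, (((m.negOnePow : ℤˣ) : ℤ) : ℝ) ^ 2 = 1 := fun m => by
      rcases Int.units_eq_one_or m.negOnePow with h | h <;> simp [h]
    rw [zero_add, hT, hU]
    rcases Int.even_or_odd (n : ℤ) with h | h
    · rw [T_eval_zero_of_even ℝ h, U_eval_zero_of_odd ℝ (h.sub_odd odd_one), hsq]
      simp
    · rw [T_eval_zero_of_odd ℝ h, U_eval_zero_of_even ℝ (h.sub_odd odd_one), mul_pow, hsq]
      simp
  | succ j ih =>
    have h := iterDerivT_ode n j 0
    have hn : (j : ℝ) ≤ n := by exact_mod_cast (Nat.le_succ j).trans hj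
    have h₁ : ((n : ℝ) ^ 2 - j ^ 2) ^ 2 ≤ ((n : ℝ) ^ 2) ^ 2 := by
      have : (j : ℝ) ^ 2 ≤ (n : ℝ) ^ 2 := pow_le_pow_left₀ j.cast_nonneg hn 2
      exact pow_le_pow_left₀ (by linarith) (by nlinarith) 2
    have h₂ : iterDerivT n (j + 2) 0 = -(n ^ 2 - j ^ 2) * iterDerivT n j 0 := by linarith
    calc _ = (n : ℝ) ^ 2 * iterDerivT n (j + 1) 0 ^ 2
          + ((n : ℝ) ^ 2 - j ^ 2) ^ 2 * iterDerivT n j 0 ^ 2 := by rw [h₂]; ring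
      _ ≤ (n : ℝ) ^ 2 * iterDerivT n (j + 1) 0 ^ 2
          + ((n : ℝ) ^ 2) ^ 2 * iterDerivT n j 0 ^ 2 := by gcongr
      _ = (n : ℝ) ^ 2 * (n ^ 2 * iterDerivT n j 0 ^ 2 + iterDerivT n (j + 1) 0 ^ 2) := by ring
      _ ≤ (n : ℝ) ^ 2 * n ^ (2 * j + 2) := by gcongr; exact ih (by omega)
      _ = _ := by ring

/-- With `x = cos θ` and `v = sin^(m+1) θ * T_n^(m+1)(cos θ)`, which solves `v'' + q v = 0` for
`q = n ^ 2 - m (m + 1) / sin² θ`, this is the energy `q v ^ 2 + v' ^ 2`. -/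
noncomputable def energy (n m : ℕ) (x : ℝ) : ℝ :=
  (1 - x ^ 2) ^ m * ((n ^ 2 * (1 - x ^ 2) - (m + 1) * m) * iterDerivT n (m + 1) x ^ 2 +
    ((m + 1) * x * iterDerivT n (m + 1) x - (1 - x ^ 2) * iterDerivT n (m + 2) x) ^ 2)

theorem antitoneOn_energy (n m : ℕ) : AntitoneOn (energy n m) (Set.Icc 0 1) := by
  have hderiv (x : ℝ) : ∃ d, HasDerivAt (energy n m) d x ∧ (1 - x ^ 2) * d =
      -((1 - x ^ 2) ^ m * (2 * (m + 1) * m * x * iterDerivT n (m + 1) x ^ 2)) := by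
    have h₀ := hasDerivAt_iterDerivT n (m + 1) x
    have h₁ := hasDerivAt_iterDerivT n (m + 2) x
    have hs : HasDerivAt (fun y : ℝ => 1 - y ^ 2) (-(2 * x)) x := by
      simpa using (hasDerivAt_pow 2 x).const_sub 1
    have hx : HasDerivAt (fun y : ℝ => ((m : ℝ) + 1) * y) (m + 1) x := by
      simpa using (hasDerivAt_id x).const_mul ((m : ℝ) + 1)
    refine ⟨_, (hs.pow m).mul (((((hs.const_mul ((n : ℝ) ^ 2)).sub_const _).mul (h₀.pow 2)).add
      (((hx.mul h₀).sub (hs.mul h₁)).pow 2))), ?_⟩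
    have ode := iterDerivT_ode n (m + 1) x
    have hpow : (1 - x ^ 2) * ((m : ℝ) * (1 - x ^ 2) ^ (m - 1)) = m * (1 - x ^ 2) ^ m := by
      cases m with
      | zero => simp
      | succ m => simp only [Nat.add_sub_cancel, pow_succ]; ring
    simp only [Pi.pow_apply, Pi.mul_apply, Pi.sub_apply]
    push_cast at ode ⊢
    linear_combination (-2 * x * ((n ^ 2 * (1 - x ^ 2) - (m + 1) * m) * iterDerivT n (m + 1) x ^ 2 +
      ((m + 1) * x * iterDerivT n (m + 1) x - (1 - x ^ 2) * iterDerivT n (m + 2) x) ^ 2)) * hpow -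
      (2 * ((m + 1) * x * iterDerivT n (m + 1) x - (1 - x ^ 2) * iterDerivT n (m + 2) x) *
        (1 - x ^ 2) * (1 - x ^ 2) ^ m) * ode
  have hd (x : ℝ) := (hderiv x).choose_spec.1
  refine antitoneOn_of_deriv_nonpos (convex_Icc 0 1)
    (fun x _ => (hd x).continuousAt.continuousWithinAt)
    (fun x _ => (hd x).differentiableAt.differentiableWithinAt) fun x hx => ?_
  rw [interior_Icc] at hx
  obtain ⟨d, hd, hd'⟩ := hderiv x
  have hpos : 0 < 1 - x ^ 2 := by nlinarith [hx.1, hx.2]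
  rw [hd.deriv]
  refine nonpos_of_mul_nonpos_right ?_ hpos
  rw [hd', neg_nonpos]
  have := hx.1
  positivity

theorem sq_iterDerivT_le_of_critical {n m : ℕ} (hm : m + 1 ≤ n) {x : ℝ} (hx₀ : 0 ≤ x)
    (hx₁ : x ≤ 1)
    (hx : iterDerivT n (m + 2) x = 0) :
    ((n : ℝ) ^ 2 - (m + 1) ^ 2) * (1 - x ^ 2) ^ (m + 1) * iterDerivT n (m + 1) x ^ 2 ≤
      (n : ℝ) ^ (2 * m + 4) := by
  have hs : 0 ≤ 1 - x ^ 2 := by nlinarith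
  calc _ ≤ (1 - x ^ 2) ^ m * ((n ^ 2 - (m + 1) ^ 2) * (1 - x ^ 2) + (m + 1)) *
        iterDerivT n (m + 1) x ^ 2 := by
          have : 0 ≤ (1 - x ^ 2) ^ m * (m + 1) * iterDerivT n (m + 1) x ^ 2 := by positivity
          linear_combination this
    _ = energy n m x := by rw [energy, hx]; ring
    _ ≤ energy n m 0 := antitoneOn_energy n m ⟨le_rfl, zero_le_one⟩ ⟨hx₀, hx₁⟩ hx₀
    _ ≤ (n : ℝ) ^ 2 * iterDerivT n (m + 1) 0 ^ 2 + iterDerivT n (m + 1 + 1) 0 ^ 2 := by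
          have : 0 ≤ ((m : ℝ) + 1) * m * iterDerivT n (m + 1) 0 ^ 2 := by positivity
          simp only [energy]
          linear_combination this
    _ ≤ (n : ℝ) ^ (2 * m + 4) := by simpa [mul_add] using iterDerivT_zero_sq_add_le hm

/-- Sturm comparison of `T_n^(j)` with `(x - a) ^ (q + 2)` on `(ω, 1)`, where `ω` is the largest
zero of `T_n^(j)`: the power cannot be a strict supersolution of the ultraspherical equation. -/
theorem not_forall_supersolution_neg {n j q : ℕ} {a ω : ℝ} (hω₀ : 0 ≤ ω)
    (hω₁ : ω < 1) (ha : a < ω) (hω : iterDerivT n j ω = 0)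
    (hpos : ∀ x, ω < x → x ≤ 1 → 0 < iterDerivT n j x) :
    ¬ ∀ x, ω < x → x < 1 →
      ((q : ℝ) + 2) * (q + 1) * (1 - x ^ 2) - (2 * j + 1) * (q + 2) * x * (x - a) +
        ((n : ℝ) ^ 2 - j ^ 2) * (x - a) ^ 2 < 0 := by
  intro hsup
  set g : ℝ → ℝ := fun x => iterDerivT n (j + 1) x * (x - a) ^ (q + 2) -
    iterDerivT n j x * ((q + 2) * (x - a) ^ (q + 1)) with hg
  set W : ℝ → ℝ := fun x => (1 - x ^ 2) ^ ((j : ℝ) + 1 / 2) * g x with hW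
  have hgc : Continuous g := by
    have h₀ := continuous_iterDerivT n j
    have h₁ := continuous_iterDerivT n (j + 1)
    fun_prop
  have hWc : Continuous W := by
    refine Continuous.mul (Continuous.rpow_const (by fun_prop) fun x => Or.inr (by positivity)) hgc
  have hderiv (x : ℝ) (hx : ω < x) (hx₁ : x < 1) : 0 < deriv W x := by
    have hs : 0 < 1 - x ^ 2 := by nlinarith
    have h₀ := hasDerivAt_iterDerivT n j x
    have h₁ := hasDerivAt_iterDerivT n (j + 1) x
    have hlin : HasDerivAt (fun y : ℝ => y - a) 1 x := (hasDerivAt_id x).sub_const a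
    have hs' : HasDerivAt (fun y : ℝ => 1 - y ^ 2) (-(2 * x)) x := by
      simpa using (hasDerivAt_pow 2 x).const_sub 1
    have hw := hs'.rpow_const (p := (j : ℝ) + 1 / 2) (Or.inl hs.ne')
    have hg' := (h₁.mul (hlin.pow (q + 2))).sub
      (h₀.mul ((hlin.pow (q + 1)).const_mul ((q : ℝ) + 2)))
    have ode := iterDerivT_ode n j x
    have hd := hw.mul hg'
    have hpow : (1 - x ^ 2) ^ ((j : ℝ) + 1 / 2) =
        (1 - x ^ 2) ^ ((j : ℝ) + 1 / 2 - 1) * (1 - x ^ 2) := by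
      rw [← Real.rpow_add_one hs.ne', sub_add_cancel]
    rw [show deriv W x = _ from hd.deriv, hpow]
    have hpos' : 0 < (1 - x ^ 2) ^ ((j : ℝ) + 1 / 2 - 1) *
        (iterDerivT n j x * ((x - a) ^ q * -(((q : ℝ) + 2) * (q + 1) * (1 - x ^ 2) -
          (2 * j + 1) * (q + 2) * x * (x - a) + ((n : ℝ) ^ 2 - j ^ 2) * (x - a) ^ 2))) := by
      have h₁ := hpos x hx hx₁.le
      have h₂ := neg_pos.mpr (hsup x hx hx₁)
      have h₃ : 0 < x - a := by linarith
      have h₄ := Real.rpow_pos_of_pos hs ((j : ℝ) + 1 / 2 - 1)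
      positivity
    refine hpos'.trans_eq ?_
    simp only [Pi.pow_apply, Pi.mul_apply, Pi.sub_apply, Nat.add_sub_cancel,
      show q + 2 - 1 = q + 1 from rfl]
    push_cast
    linear_combination (-(1 - x ^ 2) ^ ((j : ℝ) + 1 / 2 - 1) * (x - a) ^ (q + 2)) * ode
  have hmono : StrictMonoOn W (Set.Icc ω 1) := by
    refine strictMonoOn_of_deriv_pos (convex_Icc ω 1) hWc.continuousOn fun x hx => ?_
    rw [interior_Icc] at hx
    exact hderiv x hx.1 hx.2
  have hlt := hmono ⟨le_rfl, hω₁.le⟩ ⟨hω₁.le, le_rfl⟩ hω₁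
  have hW₁ : W 1 = 0 := by
    have : (j : ℝ) + 1 / 2 ≠ 0 := by positivity
    simp only [hW, one_pow, sub_self, Real.zero_rpow this, zero_mul]
  have hderivω : 0 ≤ iterDerivT n (j + 1) ω := by
    refine ge_of_tendsto ((hasDerivWithinAt_iff_tendsto_slope' Set.self_notMem_Ioi).mp
      (hasDerivAt_iterDerivT n j ω).hasDerivWithinAt) ?_
    filter_upwards [Ioc_mem_nhdsGT hω₁] with x hx
    rw [slope_def_field, hω, sub_zero]
    exact div_nonneg (hpos x hx.1 hx.2).le (sub_nonneg.mpr hx.1.le)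
  have hWω : 0 ≤ W ω := by
    have h₁ : 0 ≤ 1 - ω ^ 2 := by nlinarith
    have h₂ : 0 < ω - a := by linarith
    simp only [hW, hg, hω, zero_mul, sub_zero]
    positivity
  linarith

theorem sq_le_of_largest_zero {n j : ℕ} (hj : 2 ≤ j) {ω : ℝ} (hω₀ : 0 ≤ ω) (hjn : j < n)
    (hn : ((j : ℝ) + 1) ^ 4 ≤ n ^ 2)
    (hn' : ((2 * j + 1) * (j + 2) : ℝ) ^ 2 ≤ n ^ 2 - j ^ 2) (hω : iterDerivT n j ω = 0)
    (hmax : ∀ x, iterDerivT n j x = 0 → x ≤ ω) :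
    ((j : ℝ) + 1) ^ 2 ≤ n ^ 2 * (1 - ω ^ 2) := by
  by_contra! hlt
  have hω₁ : ω < 1 := lt_one_of_iterDerivT_eq_zero hjn.le hω
  have hpos (x : ℝ) (hx : ω < x) (hx₁ : x ≤ 1) : 0 < iterDerivT n j x := by
    by_contra! hneg
    obtain ⟨c, hc, hc'⟩ := intermediate_value_Icc hx₁ (continuous_iterDerivT n j).continuousOn
      ⟨hneg, (iterDerivT_one_pos hjn.le).le⟩
    linarith [hmax c hc', hc.1]
  obtain ⟨q, hq⟩ : ∃ q : ℕ, j = 2 * q + 2 ∨ j = 2 * q + 3 := ⟨(j - 2) / 2, by omega⟩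
  set L : ℝ := (n : ℝ) ^ 2 - j ^ 2 with hL
  have hj' : (2 : ℝ) ≤ j := by exact_mod_cast hj
  have hLpos : 0 < L := lt_of_lt_of_le (by positivity) hn'
  have hp : ((q : ℝ) + 2) * (2 * j + 3 - 2 * (q + 2)) = (j + 1) * (j + 2) / 2 := by
    rcases hq with rfl | rfl <;> push_cast <;> ring
  have hqj : (q : ℝ) + 2 ≤ j + 2 := by gcongr; omega
  have hjq : (j : ℝ) + 1 ≤ 2 * (q + 2) := by norm_cast; omega
  set D : ℝ := (2 * j + 1) * (q + 2) with hD
  have hDL : D ^ 2 / L ≤ 1 := by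
    rw [div_le_one hLpos]
    refine le_trans ?_ hn'
    rw [hD]
    gcongr
  have hbound : 2 * (L * (1 - ω)) < (j + 1) ^ 2 + 1 := by
    have h₁ : n ^ 2 * (1 - ω) < ((j : ℝ) + 1) ^ 2 := by
      refine lt_of_le_of_lt ?_ hlt
      gcongr
      nlinarith
    have h₂ : ((n : ℝ) ^ 2 * (1 - ω)) ^ 2 < n ^ 2 := by
      have : 0 ≤ 1 - ω := by linarith
      calc ((n : ℝ) ^ 2 * (1 - ω)) ^ 2 < (((j : ℝ) + 1) ^ 2) ^ 2 := by gcongr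
        _ = ((j : ℝ) + 1) ^ 4 := by ring
        _ ≤ _ := hn
    have hn0 : (0 : ℝ) < n ^ 2 := by nlinarith
    have h₃ : (n : ℝ) ^ 2 * (1 - ω) ^ 2 < 1 := by
      refine lt_of_mul_lt_mul_left ?_ hn0.le
      linarith
    have h₄ : L * (1 - ω) ≤ n ^ 2 * (1 - ω) := by
      have : 0 ≤ 1 - ω := by linarith
      gcongr
      nlinarith
    nlinarith
  refine not_forall_supersolution_neg (a := 1 - D / L) (q := q) hω₀ hω₁ ?_ hω hpos ?_
  · have : 1 - ω < D / L := by
      rw [lt_div_iff₀ hLpos]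
      nlinarith
    linarith
  · intro x hx hx₁
    have ht : 0 < 1 - x := by linarith
    have hLt : L * (1 - x) ≤ L * (1 - ω) := by gcongr
    have hneg : ((q : ℝ) + 2) * (q + 1) * (1 + x) - D + D ^ 2 / L - D * (1 - x) +
        L * (1 - x) < 0 := by
      have h₁ : 0 ≤ ((q : ℝ) + 2) * (q + 1) * (1 - x) := by positivity
      have h₂ : 0 ≤ D * (1 - x) := by positivity
      nlinarith
    have hLne := hLpos.ne'
    calc _ = (1 - x) * (((q : ℝ) + 2) * (q + 1) * (1 + x) - D + D ^ 2 / L - D * (1 - x) +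
          L * (1 - x)) := by
            rw [← hD]
            field_simp
            ring
      _ < 0 := mul_neg_of_pos_of_neg ht hneg

end Polynomial.Chebyshev

theorem stmt3 (k : ℕ) (hk : 1 ≤ k) (ω : ℕ → ℝ)
    (hωroot : ∀ n : ℕ, k + 1 < n →
      (derivative^[k + 1] (Chebyshev.T ℝ (n : ℤ))).eval (ω n) = 0)
    (hωmax : ∀ n : ℕ, k + 1 < n → ∀ x : ℝ,
      (derivative^[k + 1] (Chebyshev.T ℝ (n : ℤ))).eval x = 0 → x ≤ ω n)
    (τstar : ℝ)
    (hlim : Filter.Tendsto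
      (fun n : ℕ => |(derivative^[k] (Chebyshev.T ℝ (n : ℤ))).eval (ω n)| /
        (derivative^[k] (Chebyshev.T ℝ (n : ℤ))).eval 1)
      Filter.atTop (nhds τstar)) :
    τstar ≤ oddDoubleFac k / ((k : ℝ) + 2) ^ k := by
  have hratio (l : ℕ) : Filter.Tendsto (fun n : ℕ => (n : ℝ) ^ 2 / (n ^ 2 - l ^ 2))
      Filter.atTop (nhds 1) := by
    have hsq : Filter.Tendsto (fun n : ℕ => (n : ℝ) ^ 2) Filter.atTop Filter.atTop :=
      (Filter.tendsto_pow_atTop two_ne_zero).comp tendsto_natCast_atTop_atTop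
    have h : Filter.Tendsto (fun n : ℕ => 1 + (l : ℝ) ^ 2 / (n ^ 2 - l ^ 2)) Filter.atTop
        (nhds (1 + 0)) :=
      tendsto_const_nhds.add (tendsto_const_nhds.div_atTop
        (Filter.tendsto_atTop_add_const_right _ (-(l : ℝ) ^ 2) hsq))
    rw [add_zero] at h
    refine h.congr' ?_
    filter_upwards [Filter.eventually_gt_atTop l] with n hn
    have : (0 : ℝ) < n ^ 2 - l ^ 2 :=
      sub_pos.mpr (pow_lt_pow_left₀ (by exact_mod_cast hn) l.cast_nonneg two_ne_zero)
    field_simp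
    ring
  set B : ℝ := oddDoubleFac k / ((k : ℝ) + 2) ^ k with hB
  have hBpos : 0 < B := div_pos (Chebyshev.oddDoubleFac_pos k) (by positivity)
  have hmajorant : Filter.Tendsto (fun n : ℕ => B ^ 2 * ((n : ℝ) ^ 2 / (n ^ 2 - k ^ 2)) *
      (∏ l ∈ range k, (n : ℝ) ^ 2 / (n ^ 2 - l ^ 2)) ^ 2) Filter.atTop (nhds (B ^ 2)) := by
    simpa using ((hratio k).const_mul (B ^ 2)).mul
      ((tendsto_finsetProd (range k) fun l _ => hratio l).pow 2)
  refine le_of_sq_le_sq ?_ hBpos.le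
  refine le_of_tendsto_of_tendsto (hlim.pow 2) hmajorant ?_
  have hlarge (c : ℝ) : ∀ᶠ n : ℕ in Filter.atTop, c ≤ (n : ℝ) ^ 2 :=
    ((Filter.tendsto_pow_atTop two_ne_zero).comp
      tendsto_natCast_atTop_atTop).eventually_ge_atTop c
  filter_upwards [Filter.eventually_gt_atTop (k + 1), hlarge ((((k + 1 : ℕ) : ℝ) + 1) ^ 4),
    hlarge (((2 * ((k + 1 : ℕ) : ℝ) + 1) * ((k + 1 : ℕ) + 2)) ^ 2 + ((k + 1 : ℕ) : ℝ) ^ 2)]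
    with n hn hn₁ hn₂
  have hroot : Chebyshev.iterDerivT n (k + 1) (ω n) = 0 := hωroot n hn
  have hmax : ∀ x, Chebyshev.iterDerivT n (k + 1) x = 0 → x ≤ ω n := hωmax n hn
  have hω₀ : 0 ≤ ω n := by
    obtain ⟨c, hc⟩ := Chebyshev.exists_iterDerivT_neg n (k + 1)
    linarith [hmax (-ω n) (by rw [hc, hroot, mul_zero])]
  have hω₁ := Chebyshev.lt_one_of_iterDerivT_eq_zero hn.le hroot
  have hzero := Chebyshev.sq_le_of_largest_zero (by omega) hω₀ hn hn₁ (by linarith) hroot hmax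
  have hval : ((n : ℝ) ^ 2 - k ^ 2) * (1 - ω n ^ 2) ^ k * Chebyshev.iterDerivT n k (ω n) ^ 2 ≤
      (n : ℝ) ^ (2 * k + 2) := by
    obtain ⟨m, rfl⟩ : ∃ m, k = m + 1 := ⟨k - 1, by omega⟩
    have := Chebyshev.sq_iterDerivT_le_of_critical (by omega) hω₀ hω₁.le hroot
    push_cast
    exact this
  change (|Chebyshev.iterDerivT n k (ω n)| / Chebyshev.iterDerivT n k 1) ^ 2 ≤ _
  have hkn : (0 : ℝ) < n ^ 2 - k ^ 2 :=
    sub_pos.mpr (pow_lt_pow_left₀ (by exact_mod_cast (by omega : k < n)) k.cast_nonneg two_ne_zero)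
  have hn0 : (0 : ℝ) < n := by exact_mod_cast (by omega : 0 < n)
  have hprod : 0 < ∏ l ∈ range k, ((n : ℝ) ^ 2 - l ^ 2) := prod_pos fun l hl =>
    sub_pos.mpr (pow_lt_pow_left₀
      (by exact_mod_cast (by have := mem_range.mp hl; omega : l < n)) l.cast_nonneg two_ne_zero)
  have hodd := Chebyshev.oddDoubleFac_pos k
  rw [div_pow, sq_abs, Chebyshev.iterDerivT_one, prod_div_distrib, prod_const, card_range, hB]
  set u := Chebyshev.iterDerivT n k (ω n)
  set Q := ∏ l ∈ range k, ((n : ℝ) ^ 2 - l ^ 2)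
  have hu : (((k : ℝ) + 2) ^ k) ^ 2 * (n ^ 2 - k ^ 2) * u ^ 2 ≤ n ^ 2 * ((n ^ 2) ^ k) ^ 2 := by
    calc (((k : ℝ) + 2) ^ k) ^ 2 * (n ^ 2 - k ^ 2) * u ^ 2
        = ((((k + 1 : ℕ) : ℝ) + 1) ^ 2) ^ k * (n ^ 2 - k ^ 2) * u ^ 2 := by
          push_cast
          rw [← pow_mul, ← pow_mul, mul_comm k 2]
          ring
      _ ≤ (n ^ 2 * (1 - ω n ^ 2)) ^ k * (n ^ 2 - k ^ 2) * u ^ 2 := by gcongr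
      _ = (n ^ 2) ^ k * ((n ^ 2 - k ^ 2) * (1 - ω n ^ 2) ^ k * u ^ 2) := by rw [mul_pow]; ring
      _ ≤ (n ^ 2) ^ k * n ^ (2 * k + 2) := by gcongr
      _ = n ^ 2 * ((n ^ 2) ^ k) ^ 2 := by ring
  calc u ^ 2 / (Q / oddDoubleFac k) ^ 2
      = (((k : ℝ) + 2) ^ k) ^ 2 * (n ^ 2 - k ^ 2) * u ^ 2 * (oddDoubleFac k ^ 2 /
          ((((k : ℝ) + 2) ^ k) ^ 2 * (n ^ 2 - k ^ 2) * Q ^ 2)) := by field_simp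
    _ ≤ n ^ 2 * ((n ^ 2) ^ k) ^ 2 * (oddDoubleFac k ^ 2 /
          ((((k : ℝ) + 2) ^ k) ^ 2 * (n ^ 2 - k ^ 2) * Q ^ 2)) := by gcongr
    _ = _ := by field_simp
end

section
/- Let n and k be integers with k ≥ 1 and n > k+1, and let ω = ω_{n,k} be the largest real zero of T_n^{(k+1)}. Then τ_{n,k}² ≤ sqrt((n+k)/(n-k)) · ((2k-1)!!/(2k)!!) · (binom(n+k, n-k))⁻¹ · (1-ω²)^{-k} · sqrt(S_{n,k}(ω)/S_{n,k+1}(ω)). -/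
open Polynomial Finset

/-- The even double factorial `(2k)!! = 2·4⋯(2k)`. -/
noncomputable def evenDoubleFac (k : ℕ) : ℝ := ∏ j ∈ Finset.range k, (2 * (j : ℝ) + 2)

/-- `S_{n,k}(x) = 1 + Σ_{m=1}^{k-1} ((2m-1)!!/(2m)!!) (k-m)_{2m} (1-x²)^{-m} ∏_{j=1}^m (n²-j²)⁻¹`. -/
noncomputable def S (n k : ℕ) (x : ℝ) : ℝ :=
  1 + ∑ m ∈ Finset.Icc 1 (k - 1),
    (oddDoubleFac m / evenDoubleFac m) *
      ((ascPochhammer ℝ (2 * m)).eval ((k : ℝ) - (m : ℝ))) *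
      ((1 - x ^ 2) ^ m)⁻¹ *
      ∏ j ∈ Finset.Icc 1 m, ((n : ℝ) ^ 2 - (j : ℝ) ^ 2)⁻¹

/-- The coefficient of `(1 - x²)⁻ᵐ` in `S n k x`. -/
noncomputable def coeffS (n k m : ℕ) : ℝ :=
  oddDoubleFac m / evenDoubleFac m * (ascPochhammer ℝ (2 * m)).eval ((k : ℝ) - (m : ℝ)) *
    ∏ j ∈ Finset.Icc 1 m, ((n : ℝ) ^ 2 - (j : ℝ) ^ 2)⁻¹

lemma evenDoubleFac_pos (k : ℕ) : 0 < evenDoubleFac k :=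
  Finset.prod_pos fun _ _ => by positivity

lemma ascPochhammer_eval_succ_left (p : ℕ) (y : ℝ) :
    (ascPochhammer ℝ (p + 1)).eval y = y * (ascPochhammer ℝ p).eval (y + 1) := by
  simp [ascPochhammer_succ_left, eval_comp]

lemma coeffS_zero_right (n k : ℕ) : coeffS n k 0 = 1 := by
  simp [coeffS, oddDoubleFac, evenDoubleFac]

lemma ascPochhammer_eval_sub_eq_zero {k m : ℕ} (hm : 0 < m) (hkm : k ≤ m) :
    (ascPochhammer ℝ (2 * m)).eval ((k : ℝ) - m) = 0 := by
  rw [ascPochhammer_eval_eq_zero_iff]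
  exact ⟨m - k, by omega, by push_cast [Nat.cast_sub hkm]; ring⟩

lemma coeffS_eq_zero (n : ℕ) {k m : ℕ} (hm : 0 < m) (hkm : k ≤ m) : coeffS n k m = 0 := by
  simp [coeffS, ascPochhammer_eval_sub_eq_zero hm hkm]

lemma add_mul_coeffS (n k m : ℕ) :
    ((k : ℝ) + m) * coeffS n k m = ((k : ℝ) - m) * coeffS n (k + 1) m := by
  have h1 := ascPochhammer_succ_eval (2 * m) ((k : ℝ) - m)
  have h2 := ascPochhammer_eval_succ_left (2 * m) ((k : ℝ) - m)
  rw [h1] at h2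
  have h3 : ((k + 1 : ℕ) : ℝ) - m = (k : ℝ) - m + 1 := by push_cast; ring
  simp only [coeffS, h3]
  push_cast at h2
  linear_combination (oddDoubleFac m / evenDoubleFac m *
    ∏ j ∈ Finset.Icc 1 m, ((n : ℝ) ^ 2 - (j : ℝ) ^ 2)⁻¹) * h2

lemma coeffS_add_two_succ (n k m : ℕ) (hm : m + 1 < n) :
    ((n : ℝ) ^ 2 - (k + 1) ^ 2) * coeffS n (k + 2) (m + 1) =
      (2 * k + 1) * ((2 * m + 1) * coeffS n (k + 1) m - (2 * m + 3) * coeffS n (k + 1) (m + 1)) +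
        ((n : ℝ) ^ 2 - k ^ 2) * coeffS n k (m + 1) := by
  have hn : ((n : ℝ) ^ 2 - (m + 1) ^ 2) ≠ 0 := by
    have : ((m : ℝ) + 1) < n := by exact_mod_cast hm
    nlinarith [(m.cast_nonneg : (0 : ℝ) ≤ m)]
  have he := (evenDoubleFac_pos m).ne'
  have hodd : oddDoubleFac (m + 1) = oddDoubleFac m * (2 * m + 1) := by
    simp [oddDoubleFac, Finset.prod_range_succ]
  have heven : evenDoubleFac (m + 1) = evenDoubleFac m * (2 * m + 2) := by
    simp [evenDoubleFac, Finset.prod_range_succ]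
  have hprod : ∏ j ∈ Finset.Icc 1 (m + 1), ((n : ℝ) ^ 2 - (j : ℝ) ^ 2)⁻¹ =
      (∏ j ∈ Finset.Icc 1 m, ((n : ℝ) ^ 2 - (j : ℝ) ^ 2)⁻¹) * ((n : ℝ) ^ 2 - (m + 1) ^ 2)⁻¹ := by
    rw [Finset.prod_Icc_succ_top (by omega)]
    push_cast
    ring
  have h2m : 2 * (m + 1) = 2 * m + 1 + 1 := by ring
  have e1 : (ascPochhammer ℝ (2 * (m + 1))).eval (((k + 2 : ℕ) : ℝ) - ((m + 1 : ℕ) : ℝ)) =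
      (ascPochhammer ℝ (2 * m)).eval ((k : ℝ) + 1 - m) * (k + m + 1) * (k + m + 2) := by
    rw [h2m, ascPochhammer_succ_eval, ascPochhammer_succ_eval]
    push_cast
    ring_nf
  have e2 : (ascPochhammer ℝ (2 * (m + 1))).eval (((k + 1 : ℕ) : ℝ) - ((m + 1 : ℕ) : ℝ)) =
      (k - m) * (ascPochhammer ℝ (2 * m)).eval ((k : ℝ) + 1 - m) * (k + m + 1) := by
    rw [h2m, ascPochhammer_succ_eval, ascPochhammer_eval_succ_left]
    push_cast
    ring_nf
  have e3 : (ascPochhammer ℝ (2 * (m + 1))).eval ((k : ℝ) - ((m + 1 : ℕ) : ℝ)) =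
      (k - m - 1) * (k - m) * (ascPochhammer ℝ (2 * m)).eval ((k : ℝ) + 1 - m) := by
    rw [h2m, ascPochhammer_eval_succ_left, ascPochhammer_eval_succ_left]
    push_cast
    ring_nf
  simp only [coeffS, e1, e2, e3, hodd, heven, hprod]
  push_cast
  generalize ∏ j ∈ Finset.Icc 1 m, ((n : ℝ) ^ 2 - (j : ℝ) ^ 2)⁻¹ = Q
  generalize (ascPochhammer ℝ (2 * m)).eval ((k : ℝ) + 1 - m) = A
  have hm2 : (2 * (m : ℝ) + 2) ≠ 0 := by positivity
  field_simp
  ring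

lemma S_eq_sum_coeffS {n k : ℕ} (hk : 1 ≤ k) (hkn : k ≤ n) (x : ℝ) :
    S n k x = ∑ m ∈ Finset.range n, coeffS n k m * ((1 - x ^ 2)⁻¹) ^ m := by
  have hsub : Finset.range k ⊆ Finset.range n := Finset.range_subset_range.2 hkn
  rw [← Finset.sum_subset hsub fun m _ hm => by
    rw [coeffS_eq_zero n (by simp at hm; omega) (by simpa using hm), zero_mul]]
  obtain ⟨l, rfl⟩ : ∃ l, k = l + 1 := ⟨k - 1, by omega⟩
  rw [Finset.sum_range_succ', coeffS_zero_right, pow_zero, mul_one, add_comm _ (1 : ℝ), S,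
    Nat.add_sub_cancel, ← Finset.Ico_add_one_right_eq_Icc, Finset.sum_Ico_eq_sum_range]
  congr 1
  refine Finset.sum_congr (by simp) fun m _ => ?_
  rw [add_comm 1 m, coeffS, inv_pow]
  ring

/-- The sum `Σ_{m<n} coeffS n k m · uᵐ`. -/
noncomputable def sumS (n k : ℕ) (u : ℝ) : ℝ := ∑ m ∈ Finset.range n, coeffS n k m * u ^ m

/-- The sum `Σ_{m<n} (k + m) · coeffS n k m · uᵐ`. -/
noncomputable def weightedSumS (n k : ℕ) (u : ℝ) : ℝ :=
  ∑ m ∈ Finset.range n, ((k : ℝ) + m) * coeffS n k m * u ^ m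

lemma weightedSumS_succ (n k : ℕ) (u : ℝ) :
    weightedSumS n (k + 1) u = (2 * k + 1) * sumS n (k + 1) u - weightedSumS n k u := by
  simp only [weightedSumS, sumS, Finset.mul_sum, ← Finset.sum_sub_distrib]
  refine Finset.sum_congr rfl fun m _ => ?_
  push_cast
  linear_combination u ^ m * add_mul_coeffS n k m

lemma sumS_add_two {n k : ℕ} (hkn : k + 2 ≤ n) (u : ℝ) :
    ((n : ℝ) ^ 2 - (k + 1) ^ 2) * sumS n (k + 2) u =
      (2 * k + 1) * (u - 1) * ((2 * k + 1) * sumS n (k + 1) u - 2 * weightedSumS n k u) +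
        ((n : ℝ) ^ 2 - k ^ 2) * sumS n k u := by
  have hC : (2 * k + 1) * sumS n (k + 1) u - 2 * weightedSumS n k u =
      ∑ m ∈ Finset.range n, (2 * m + 1) * coeffS n (k + 1) m * u ^ m := by
    simp only [weightedSumS, sumS, Finset.mul_sum, ← Finset.sum_sub_distrib]
    refine Finset.sum_congr rfl fun m _ => ?_
    linear_combination - 2 * u ^ m * add_mul_coeffS n k m
  rw [hC]
  obtain ⟨N, rfl⟩ : ∃ N, n = N + 1 := ⟨n - 1, by omega⟩
  have hshift : u * ∑ m ∈ Finset.range (N + 1), (2 * m + 1) * coeffS (N + 1) (k + 1) m * u ^ m =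
      ∑ m ∈ Finset.range N, (2 * m + 1) * coeffS (N + 1) (k + 1) m * u ^ (m + 1) := by
    rw [Finset.sum_range_succ, coeffS_eq_zero (N + 1) (k := k + 1) (m := N) (by omega) (by omega),
      mul_zero, zero_mul, add_zero, Finset.mul_sum]
    exact Finset.sum_congr rfl fun m _ => by ring
  have hsplit : ∀ F : ℝ, (2 * (k : ℝ) + 1) * (u - 1) * F =
      (2 * k + 1) * (u * F) - (2 * k + 1) * F := fun F => by ring
  rw [hsplit, hshift]
  simp only [sumS, Finset.sum_range_succ', coeffS_zero_right]
  have key : ((N + 1 : ℕ) ^ 2 - ((k : ℝ) + 1) ^ 2) *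
        ∑ m ∈ Finset.range N, coeffS (N + 1) (k + 2) (m + 1) * u ^ (m + 1) =
      (2 * k + 1) * ∑ m ∈ Finset.range N, (2 * m + 1) * coeffS (N + 1) (k + 1) m * u ^ (m + 1) -
      (2 * k + 1) * ∑ m ∈ Finset.range N,
        (2 * ((m + 1 : ℕ) : ℝ) + 1) * coeffS (N + 1) (k + 1) (m + 1) * u ^ (m + 1) +
      ((N + 1 : ℕ) ^ 2 - (k : ℝ) ^ 2) *
        ∑ m ∈ Finset.range N, coeffS (N + 1) k (m + 1) * u ^ (m + 1) := by
    simp only [Finset.mul_sum, ← Finset.sum_sub_distrib, ← Finset.sum_add_distrib]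
    refine Finset.sum_congr rfl fun m hm => ?_
    have h := coeffS_add_two_succ (N + 1) k m (by simpa using hm)
    push_cast at h ⊢
    linear_combination u ^ (m + 1) * h
  push_cast at key ⊢
  linear_combination key

/-- `∏_{j<k} (n² - j²)`. -/
noncomputable def diffSqProd (n k : ℕ) : ℝ := ∏ j ∈ Finset.range k, ((n : ℝ) ^ 2 - (j : ℝ) ^ 2)

lemma diffSqProd_succ (n k : ℕ) :
    diffSqProd n (k + 1) = diffSqProd n k * ((n : ℝ) ^ 2 - k ^ 2) :=
  Finset.prod_range_succ _ _

lemma diffSqProd_pos {n k : ℕ} (hkn : k ≤ n) : 0 < diffSqProd n k := by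
  refine Finset.prod_pos fun j hj => ?_
  have : (j : ℝ) < n := by
    have := Finset.mem_range.1 hj
    exact_mod_cast this.trans_le hkn
  nlinarith [(j.cast_nonneg : (0 : ℝ) ≤ j)]

/-- The three-term recurrence satisfied at the point `x` by the successive derivatives of a
solution of the Chebyshev equation, where `u = (1 - x²)⁻¹`. -/
def ChebyshevRec (n : ℕ) (x u : ℝ) (y : ℕ → ℝ) : Prop :=
  ∀ k, y (k + 2) = u * ((2 * k + 1) * x * y (k + 1) - ((n : ℝ) ^ 2 - k ^ 2) * y k)

lemma wronskian_eq {n : ℕ} {x u : ℝ} {t v : ℕ → ℝ} (ht : ChebyshevRec n x u t)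
    (hv : ChebyshevRec n x u v) (k : ℕ) :
    t k * v (k + 1) - t (k + 1) * v k =
      diffSqProd n k * u ^ k * (t 0 * v 1 - t 1 * v 0) := by
  induction k with
  | zero => simp [diffSqProd]
  | succ k ih =>
    rw [ht k, hv k, diffSqProd_succ]
    linear_combination u * ((n : ℝ) ^ 2 - k ^ 2) * ih

lemma sq_add_sq_eq {n : ℕ} {x u : ℝ} {t v : ℕ → ℝ} (ht : ChebyshevRec n x u t)
    (hv : ChebyshevRec n x u v) (hu : u * x ^ 2 = u - 1) (hn : 1 ≤ n)
    (h0 : t 0 ^ 2 + v 0 ^ 2 = 1) (h01 : t 0 * t 1 + v 0 * v 1 = 0)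
    (h1 : t 1 ^ 2 + v 1 ^ 2 = n ^ 2 * u) {k : ℕ} (hk : k + 1 ≤ n) :
    t k ^ 2 + v k ^ 2 = diffSqProd n k * u ^ k * sumS n k u ∧
    t k * t (k + 1) + v k * v (k + 1) = x * diffSqProd n k * u ^ (k + 1) * weightedSumS n k u ∧
    t (k + 1) ^ 2 + v (k + 1) ^ 2 = diffSqProd n (k + 1) * u ^ (k + 1) * sumS n (k + 1) u := by
  induction k with
  | zero =>
    obtain ⟨N, rfl⟩ : ∃ N, n = N + 1 := ⟨n - 1, by omega⟩
    have hs0 : sumS (N + 1) 0 u = 1 := by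
      simp only [sumS, Finset.sum_range_succ', coeffS_zero_right]
      rw [Finset.sum_eq_zero fun m _ => by rw [coeffS_eq_zero _ (by omega) (by omega), zero_mul]]
      simp
    have hs1 : sumS (N + 1) 1 u = 1 := by
      simp only [sumS, Finset.sum_range_succ', coeffS_zero_right]
      rw [Finset.sum_eq_zero fun m _ => by rw [coeffS_eq_zero _ (by omega) (by omega), zero_mul]]
      simp
    have hw : weightedSumS (N + 1) 0 u = 0 := by
      simp only [weightedSumS, Finset.sum_range_succ', coeffS_zero_right]
      rw [Finset.sum_eq_zero fun m _ => by rw [coeffS_eq_zero _ (by omega) (by omega)]; ring]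
      simp
    refine ⟨?_, ?_, ?_⟩
    · simp [hs0, h0, diffSqProd]
    · simp [hw, h01]
    · simp [hs1, h1, diffSqProd]
  | succ k ih =>
    obtain ⟨hD, hE, hD1⟩ := ih (by omega)
    refine ⟨hD1, ?_, ?_⟩
    · rw [ht k, hv k, weightedSumS_succ]
      rw [diffSqProd_succ] at hD1 ⊢
      linear_combination u * (2 * k + 1) * x * hD1 - u * ((n : ℝ) ^ 2 - k ^ 2) * hE
    · have hs := sumS_add_two (n := n) (k := k) (by omega) u
      rw [ht k, hv k, diffSqProd_succ n (k + 1)]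
      rw [diffSqProd_succ] at hD1 ⊢
      push_cast
      linear_combination u ^ 2 * (2 * k + 1) ^ 2 * x ^ 2 * hD1 -
        2 * u ^ 2 * (2 * k + 1) * x * ((n : ℝ) ^ 2 - k ^ 2) * hE +
        u ^ 2 * ((n : ℝ) ^ 2 - k ^ 2) ^ 2 * hD -
        diffSqProd n k * ((n : ℝ) ^ 2 - k ^ 2) * u ^ (k + 2) * hs +
        diffSqProd n k * ((n : ℝ) ^ 2 - k ^ 2) * u ^ (k + 2) * (2 * k + 1) *
          ((2 * k + 1) * sumS n (k + 1) u - 2 * weightedSumS n k u) * hu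

/-- The solution of the Chebyshev recurrence with prescribed initial values. -/
noncomputable def chebyshevRecSol (n : ℕ) (x u a b : ℝ) : ℕ → ℝ
  | 0 => a
  | 1 => b
  | k + 2 => u * ((2 * k + 1) * x * chebyshevRecSol n x u a b (k + 1) -
      ((n : ℝ) ^ 2 - k ^ 2) * chebyshevRecSol n x u a b k)

lemma iterate_derivative_T_eval_one_le (n k : ℕ) {x : ℝ} (hx : 1 ≤ x) :
    (derivative^[k] (Chebyshev.T ℝ n)).eval 1 ≤ (derivative^[k] (Chebyshev.T ℝ n)).eval x := by
  refine Submodule.span_induction (p := fun p _ => p.eval 1 ≤ p.eval x) ?_ ?_ ?_ ?_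
    (Chebyshev.T_iterate_derivative_mem_span_T (R := ℝ) n k)
  · rintro _ ⟨m, _, rfl⟩
    simpa using Chebyshev.one_le_eval_T_real m hx
  · simp
  · intro p q _ _ hp hq
    simpa using add_le_add hp hq
  · intro a p _ hp
    simpa using mul_le_mul_of_nonneg_left hp (Nat.cast_nonneg a)

lemma iterate_derivative_T_eval_neg_eq_zero {n k : ℕ} {x : ℝ}
    (h : (derivative^[k] (Chebyshev.T ℝ n)).eval x = 0) :
    (derivative^[k] (Chebyshev.T ℝ n)).eval (-x) = 0 := by
  have hT : (Chebyshev.T ℝ n).comp (-X) = C (((n : ℤ).negOnePow : ℤ) : ℝ) * Chebyshev.T ℝ n := by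
    refine Polynomial.funext fun y => ?_
    rw [eval_comp, eval_neg, eval_X, Chebyshev.T_eval_neg, eval_mul, eval_C]
  have h1 := congrArg (eval x) (iterate_derivative_comp_neg_X (Chebyshev.T ℝ n) k)
  rw [hT, iterate_derivative_C_mul, eval_mul, h, mul_zero, eval_mul, eval_comp] at h1
  simpa using h1.symm

lemma diffSqProd_eq_oddDoubleFac_mul (n k : ℕ) :
    diffSqProd n k = oddDoubleFac k * (derivative^[k] (Chebyshev.T ℝ n)).eval 1 := by
  have h := Chebyshev.iterate_derivative_T_eval_one (R := ℝ) n k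
  push_cast at h
  exact h.symm

lemma iterate_derivative_T_eval_one_pos {n k : ℕ} (hk : k ≤ n) :
    0 < (derivative^[k] (Chebyshev.T ℝ n)).eval 1 :=
  pos_of_mul_pos_right (diffSqProd_eq_oddDoubleFac_mul n k ▸ diffSqProd_pos hk)
    (oddDoubleFac_pos k).le

lemma mem_Ioo_of_iterate_derivative_T_eval_eq_zero {n k : ℕ} (hk : k ≤ n) {x : ℝ}
    (h : (derivative^[k] (Chebyshev.T ℝ n)).eval x = 0) : x ∈ Set.Ioo (-1 : ℝ) 1 := by
  have hlt : ∀ y : ℝ, (derivative^[k] (Chebyshev.T ℝ n)).eval y = 0 → y < 1 := by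
    intro y hy
    by_contra! hy1
    have := iterate_derivative_T_eval_one_le n k hy1
    linarith [iterate_derivative_T_eval_one_pos hk]
  exact ⟨by linarith [hlt _ (iterate_derivative_T_eval_neg_eq_zero h)], hlt x h⟩

lemma factorial_two_mul_eq (k : ℕ) :
    ((2 * k).factorial : ℝ) = oddDoubleFac k * evenDoubleFac k := by
  induction k with
  | zero => simp [oddDoubleFac, evenDoubleFac]
  | succ k ih =>
    rw [show 2 * (k + 1) = 2 * k + 1 + 1 by ring, Nat.factorial_succ, Nat.factorial_succ]
    push_cast
    rw [ih]
    simp only [oddDoubleFac, evenDoubleFac, Finset.prod_range_succ]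
    ring

lemma diffSqProd_mul_factorial {n k : ℕ} (hk : k ≤ n) :
    ((n : ℝ) + k) * diffSqProd n k * (n - k).factorial = n * (n + k).factorial := by
  induction k with
  | zero => simp [diffSqProd]
  | succ k ih =>
    have h := ih (by omega)
    have hf : (n - k).factorial = (n - k) * (n - (k + 1)).factorial := by
      rw [show n - k = (n - (k + 1)) + 1 by omega, Nat.factorial_succ]
    rw [hf, Nat.cast_mul, Nat.cast_sub (by omega)] at h
    rw [diffSqProd_succ, ← add_assoc, Nat.factorial_succ]
    push_cast
    linear_combination ((n : ℝ) + k + 1) * h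

lemma choose_mul_eq {n k : ℕ} (hk : k ≤ n) :
    (n : ℝ) * (oddDoubleFac k * evenDoubleFac k) * (Nat.choose (n + k) (n - k) : ℝ) =
      ((n : ℝ) + k) * diffSqProd n k := by
  have h := Nat.choose_mul_factorial_mul_factorial (show n - k ≤ n + k by omega)
  rw [show n + k - (n - k) = 2 * k by omega] at h
  have h' : ((Nat.choose (n + k) (n - k) : ℝ)) * (n - k).factorial *
      (oddDoubleFac k * evenDoubleFac k) = (n + k).factorial := by
    rw [← factorial_two_mul_eq]
    exact_mod_cast h
  have hne : ((n - k).factorial : ℝ) ≠ 0 := by positivity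
  refine mul_right_cancel₀ hne ?_
  rw [diffSqProd_mul_factorial hk]
  linear_combination (n : ℝ) * h'

/-- At a zero of `T_n^{(k+1)}`, comparing the Wronskian of `T_n^{(k)}` and its conjugate function
with the sums of squares bounds the fourth power of `T_n^{(k)}`. -/
lemma iterate_derivative_T_pow_four_le {n k : ℕ} (hk : 1 ≤ k) (hn : k + 1 < n) {x : ℝ}
    (h : (derivative^[k + 1] (Chebyshev.T ℝ (n : ℤ))).eval x = 0) :
    0 ≤ S n k x ∧ 0 < S n (k + 1) x ∧
    (derivative^[k] (Chebyshev.T ℝ (n : ℤ))).eval x ^ 4 * (((n : ℝ) ^ 2 - k ^ 2) * S n (k + 1) x) ≤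
      n ^ 2 * diffSqProd n k ^ 2 * ((1 - x ^ 2)⁻¹ ^ k) ^ 2 * S n k x := by
  obtain ⟨hx0, hx1⟩ := mem_Ioo_of_iterate_derivative_T_eval_eq_zero (by omega) h
  have hs : 0 < 1 - x ^ 2 := by nlinarith
  rw [S_eq_sum_coeffS hk (by omega), S_eq_sum_coeffS (by omega) (by omega)]
  change 0 ≤ sumS n k _ ∧ 0 < sumS n (k + 1) _ ∧ _ * (_ * sumS n (k + 1) _) ≤ _ * sumS n k _
  set u := (1 - x ^ 2)⁻¹ with hu_def
  have hu : 0 < u := inv_pos.2 hs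
  have hus : u * (1 - x ^ 2) = 1 := inv_mul_cancel₀ hs.ne'
  set θ := Real.arccos x
  have hcos : Real.cos θ = x := Real.cos_arccos hx0.le hx1.le
  have hsin : 0 < Real.sin θ :=
    Real.sin_pos_of_pos_of_lt_pi (Real.arccos_pos.2 hx1)
      (lt_of_le_of_ne (Real.arccos_le_pi x) fun hp => by
        rw [hp, Real.cos_pi] at hcos
        linarith)
  have hsq : Real.sin θ ^ 2 = 1 - x ^ 2 := by rw [Real.sin_sq, hcos]
  set t : ℕ → ℝ := fun j => (derivative^[j] (Chebyshev.T ℝ (n : ℤ))).eval x with ht_def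
  have ht0 : t 0 = Real.cos (n * θ) := by
    have := Chebyshev.T_real_cos θ n
    rw [hcos] at this
    simpa [ht_def] using this
  have ht1 : t 1 * Real.sin θ = n * Real.sin (n * θ) := by
    have := Chebyshev.U_real_cos θ (n - 1)
    rw [hcos] at this
    push_cast at this
    rw [sub_add_cancel] at this
    simp only [ht_def, Function.iterate_one, Chebyshev.T_derivative_eq_U, eval_mul]
    rw [mul_assoc, this]
    simp
  set r := (Real.sin θ)⁻¹ with hr_def
  have hr : r * Real.sin θ = 1 := inv_mul_cancel₀ hsin.ne'
  have hur : u = r ^ 2 := by rw [hu_def, ← hsq, hr_def, inv_pow]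
  have ht1' : t 1 = n * Real.sin (n * θ) * r := by
    linear_combination r * ht1 - t 1 * hr
  have hpy := Real.sin_sq_add_cos_sq (n * θ)
  have ht : ChebyshevRec n x u t := fun j => by
    have := Chebyshev.one_sub_X_sq_mul_iterate_derivative_T_eval (R := ℝ) n j x
    push_cast at this
    change (1 - x ^ 2) * t (j + 2) = (2 * j + 1) * x * t (j + 1) - (n ^ 2 - j ^ 2) * t j at this
    linear_combination u * this - t (j + 2) * hus
  set v := chebyshevRecSol n x u (Real.sin (n * θ)) (-n * Real.cos (n * θ) * r) with hv_def
  have hv : ChebyshevRec n x u v := fun j => by rw [hv_def, chebyshevRecSol]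
  have hv0 : v 0 = Real.sin (n * θ) := by rw [hv_def, chebyshevRecSol]
  have hv1 : v 1 = -n * Real.cos (n * θ) * r := by rw [hv_def, chebyshevRecSol]
  obtain ⟨hD, -, hD1⟩ := sq_add_sq_eq ht hv (by linear_combination -hus) (by omega)
    (by rw [ht0, hv0]; linear_combination hpy)
    (by rw [ht0, hv0, ht1', hv1]; ring)
    (by rw [ht1', hv1, hur]; linear_combination n ^ 2 * r ^ 2 * hpy)
    (k := k) (by omega)
  have hW := wronskian_eq ht hv k
  have hW0 : t 0 * v 1 - t 1 * v 0 = -n * r := by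
    rw [ht0, hv0, ht1', hv1]; linear_combination -n * r * hpy
  have htk : t (k + 1) = 0 := h
  rw [hW0, htk, zero_mul, sub_zero] at hW
  rw [htk, zero_pow two_ne_zero, zero_add] at hD1
  have hP := diffSqProd_pos (n := n) (k := k) (by omega)
  have hP1 := diffSqProd_pos (n := n) (k := k + 1) (by omega)
  have hn0 : (0 : ℝ) < n := by exact_mod_cast (by omega : 0 < n)
  have hrpos : 0 < r := inv_pos.2 hsin
  have hv_ne : v (k + 1) ≠ 0 := by
    intro hz
    rw [hz, mul_zero] at hW
    have : 0 < diffSqProd n k * u ^ k * (n * r) := by positivity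
    linarith
  have hA1 : 0 < sumS n (k + 1) u := by
    refine pos_of_mul_pos_right (a := diffSqProd n (k + 1) * u ^ (k + 1)) ?_ (by positivity)
    rw [← hD1]
    positivity
  have hA : 0 ≤ sumS n k u := by
    refine nonneg_of_mul_nonneg_right (a := diffSqProd n k * u ^ k) ?_ (by positivity)
    rw [← hD]
    positivity
  refine ⟨hA, hA1, ?_⟩
  change t k ^ 4 * _ ≤ _
  have hle : t k ^ 2 ≤ diffSqProd n k * u ^ k * sumS n k u := by
    rw [← hD]
    linarith [sq_nonneg (v k)]
  have hmul := mul_le_mul_of_nonneg_left hle (sq_nonneg (t k * v (k + 1)))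
  have hW2 : (t k * v (k + 1)) ^ 2 = n ^ 2 * diffSqProd n k ^ 2 * (u ^ k) ^ 2 * u := by
    rw [hW, hur]; ring
  have hpos : 0 < diffSqProd n k * u ^ (k + 1) := by positivity
  refine le_of_mul_le_mul_left ?_ hpos
  calc _ = (t k * v (k + 1)) ^ 2 * t k ^ 2 := by
        rw [mul_pow, hD1, diffSqProd_succ]; ring
    _ ≤ _ := hmul
    _ = _ := by rw [hW2]; ring

theorem stmt9 (n k : ℕ) (hk : 1 ≤ k) (hn : k + 1 < n) (ω : ℝ)
    (hωroot : (derivative^[k + 1] (Chebyshev.T ℝ (n : ℤ))).eval ω = 0)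
    (hωmax : ∀ x : ℝ, (derivative^[k + 1] (Chebyshev.T ℝ (n : ℤ))).eval x = 0 → x ≤ ω) :
    (|(derivative^[k] (Chebyshev.T ℝ (n : ℤ))).eval ω| /
        (derivative^[k] (Chebyshev.T ℝ (n : ℤ))).eval 1) ^ 2 ≤
      Real.sqrt (((n : ℝ) + (k : ℝ)) / ((n : ℝ) - (k : ℝ))) *
        (oddDoubleFac k / evenDoubleFac k) * ((Nat.choose (n + k) (n - k) : ℝ))⁻¹ *
        ((1 - ω ^ 2) ^ k)⁻¹ * Real.sqrt (S n k ω / S n (k + 1) ω) := by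
  obtain ⟨hS, hS1, hmain⟩ := iterate_derivative_T_pow_four_le hk hn hωroot
  have hω := mem_Ioo_of_iterate_derivative_T_eval_eq_zero (by omega) hωroot
  have hs : 0 < 1 - ω ^ 2 := by nlinarith [hω.1, hω.2]
  have hknR : (k : ℝ) < n := by exact_mod_cast (by omega : k < n)
  have hk0 : (0 : ℝ) ≤ k := k.cast_nonneg
  have hC := choose_mul_eq (n := n) (k := k) (by omega)
  have hQ := diffSqProd_eq_oddDoubleFac_mul n k
  have hQpos := iterate_derivative_T_eval_one_pos (n := n) (k := k) (by omega)
  have ho := oddDoubleFac_pos k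
  have he := evenDoubleFac_pos k
  have hP := diffSqProd_pos (n := n) (k := k) (by omega)
  have hCpos : (0 : ℝ) < Nat.choose (n + k) (n - k) := by
    exact_mod_cast Nat.choose_pos (by omega)
  have hn0 : (0 : ℝ) < n := hk0.trans_lt hknR
  have hsub : (0 : ℝ) < n - k := sub_pos.2 hknR
  have hC' : (Nat.choose (n + k) (n - k) : ℝ) =
      ((n : ℝ) + k) * diffSqProd n k / (n * (oddDoubleFac k * evenDoubleFac k)) := by
    rw [eq_div_iff (by positivity)]
    linear_combination hC
  refine le_of_sq_le_sq ?_ (by positivity)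
  set t := (derivative^[k] (Chebyshev.T ℝ (n : ℤ))).eval ω
  set Q := (derivative^[k] (Chebyshev.T ℝ (n : ℤ))).eval 1
  have hL : ((|t| / Q) ^ 2) ^ 2 = t ^ 4 / Q ^ 4 := by
    rw [div_pow, sq_abs]
    ring
  have hN : (0 : ℝ) < (n : ℝ) ^ 2 - k ^ 2 := by nlinarith
  calc ((|t| / Q) ^ 2) ^ 2 = t ^ 4 / Q ^ 4 := hL
    _ ≤ n ^ 2 * diffSqProd n k ^ 2 * ((1 - ω ^ 2)⁻¹ ^ k) ^ 2 * S n k ω /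
          (((n : ℝ) ^ 2 - k ^ 2) * S n (k + 1) ω) / Q ^ 4 := by
        gcongr
        rwa [le_div_iff₀ (by positivity)]
    _ = _ := by
        simp only [mul_pow]
        rw [Real.sq_sqrt (by positivity), Real.sq_sqrt (by positivity), hC', hQ, inv_pow,
          show (n : ℝ) ^ 2 - k ^ 2 = (n + k) * (n - k) by ring]
        have hnk : (n : ℝ) + k ≠ 0 := by positivity
        field_simp
end
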